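/- For every finite field F_q and every γ > 0 there exists τ > 0 such that the following holds: let (X₁, A₁) and (X₂, A₂) be independent pairs of random variables with X₁, X₂ ∈ F_q, such that A₁ and A₂ are identically distributed and for every value a, H̄(X₁ | A₁ = a) = H̄(X₂ | A₂ = a). If H̄(X₁ | A₁) ≤ τ, then H̄(X₁ + X₂ | A₁, A₂) ≥ (1 − γ)·(H̄(X₁ | A₁) + H̄(X₂ | A₂)). -/

import Mathlib

open MeasureTheory ProbabilityTheory Real Finset

/-- The probability mass that the random variable `X` puts on the value `a`. -/
noncomputable def massOf {Ω : Type*} [MeasurableSpace Ω] (μ : Measure Ω)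
    {S : Type*} (X : Ω → S) (a : S) : ℝ :=
  (μ (X ⁻¹' {a})).toReal

/-- Shannon entropy (in bits) of a random variable with values in a finite type. -/
noncomputable def entropy {Ω : Type*} [MeasurableSpace Ω] (μ : Measure Ω)
    {S : Type*} [Fintype S] (X : Ω → S) : ℝ :=
  (∑ a : S, Real.negMulLog (massOf μ X a)) / Real.log 2

/-- Conditional Shannon entropy (in bits) `H(X | Y)`. -/
noncomputable def condEntropy {Ω : Type*} [MeasurableSpace Ω] (μ : Measure Ω)
    {S T : Type*} [Fintype S] [Fintype T] (X : Ω → S) (Y : Ω → T) : ℝ :=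
  ∑ b : T, massOf μ Y b * entropy (μ[|Y ⁻¹' {b}]) X

/-- Normalized (`q`-ary) entropy `H̄(X) = H(X) / log₂ q`. -/
noncomputable def nEntropy {Ω : Type*} [MeasurableSpace Ω] (μ : Measure Ω)
    {S : Type*} [Fintype S] (X : Ω → S) : ℝ :=
  entropy μ X / Real.logb 2 (Fintype.card S)

/-- Normalized conditional entropy `H̄(X|Y) = H(X|Y) / log₂ q`. -/
noncomputable def nCondEntropy {Ω : Type*} [MeasurableSpace Ω] (μ : Measure Ω)
    {S T : Type*} [Fintype S] [Fintype T] (X : Ω → S) (Y : Ω → T) : ℝ :=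
  condEntropy μ X Y / Real.logb 2 (Fintype.card S)

namespace SuctionLowerEnd

lemma negMulLog_le_one_sub {x : ℝ} (hx : 0 ≤ x) : negMulLog x ≤ 1 - x := by
  rcases hx.eq_or_lt with rfl | hx
  · simp
  · have h := Real.log_le_sub_one_of_pos (inv_pos.mpr hx)
    rw [Real.log_inv] at h
    have := mul_le_mul_of_nonneg_left h hx.le
    rw [mul_sub, mul_inv_cancel₀ hx.ne'] at this
    rw [negMulLog]
    linarith

/-- If `x ≤ exp (-L)` then `-x log x` dominates `L x`. -/
lemma mul_le_negMulLog {x L : ℝ} (hx : 0 ≤ x) (hxL : x ≤ exp (-L)) :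
    L * x ≤ negMulLog x := by
  rcases hx.eq_or_lt with rfl | hx
  · simp
  · have h := Real.log_le_log hx hxL
    rw [Real.log_exp] at h
    rw [negMulLog]
    nlinarith

/-- The function `-x log x` is increasing on `[0, e⁻¹]`. -/
lemma negMulLog_mono {x y : ℝ} (hx : 0 ≤ x) (hxy : x ≤ y) (hy : y ≤ exp (-1)) :
    negMulLog x ≤ negMulLog y := by
  rcases hx.eq_or_lt with rfl | hx
  · simpa using negMulLog_nonneg hxy (hy.trans (by simp))
  · have hy0 : 0 < y := hx.trans_le hxy
    have h1 : log y ≤ -1 := by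
      have := Real.log_le_log hy0 hy
      rwa [Real.log_exp] at this
    have h2 : log y - log x ≤ y / x - 1 := by
      have := Real.log_le_sub_one_of_pos (div_pos hy0 hx)
      rwa [Real.log_div hy0.ne' hx.ne'] at this
    have h3 := mul_le_mul_of_nonneg_left h2 hx.le
    have h4 : x * (y / x - 1) = y - x := by field_simp
    rw [negMulLog, negMulLog]
    nlinarith

/-- Merging two atoms of masses `x` and `y` loses at most `x + y` nats. -/
lemma negMulLog_add_ge {x y : ℝ} (hx : 0 ≤ x) (hy : 0 ≤ y) :
    negMulLog x + negMulLog y - (x + y) ≤ negMulLog (x + y) := by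
  rcases hx.eq_or_lt with rfl | hx
  · simpa using hy
  rcases hy.eq_or_lt with rfl | hy
  · simpa using hx.le
  have hs : 0 < x + y := by positivity
  have key : ∀ z : ℝ, 0 < z → z * (log (x + y) - log z) ≤ x + y - z := by
    intro z hz
    have := Real.log_le_sub_one_of_pos (div_pos hs hz)
    rw [Real.log_div hs.ne' hz.ne'] at this
    refine (mul_le_mul_of_nonneg_left this hz.le).trans_eq ?_
    field_simp
  have h1 := key x hx
  have h2 := key y hy
  simp only [negMulLog]
  nlinarith

/-- Shannon entropy, in nats, of a mass function on a finite type. -/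
noncomputable def natEntropy {S : Type*} [Fintype S] (p : S → ℝ) : ℝ :=
  ∑ x, negMulLog (p x)

section Convolution

variable {F : Type*} [Fintype F]

lemma le_one_of_sum {p : F → ℝ} (hp : ∀ x, 0 ≤ p x) (hp1 : ∑ x, p x = 1) (x : F) : p x ≤ 1 :=
  hp1 ▸ single_le_sum (fun i _ => hp i) (mem_univ x)

lemma natEntropy_nonneg {p : F → ℝ} (hp : ∀ x, 0 ≤ p x) (hp1 : ∑ x, p x = 1) :
    0 ≤ natEntropy p :=
  sum_nonneg fun x _ => negMulLog_nonneg (hp x) (le_one_of_sum hp hp1 x)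

/-- Some atom has mass at least `1 - H`. -/
lemma exists_one_sub_le_natEntropy {p : F → ℝ} (hp : ∀ x, 0 ≤ p x) (hp1 : ∑ x, p x = 1) :
    ∃ x, 1 - p x ≤ natEntropy p := by
  have hne : (univ : Finset F).Nonempty := by
    rw [nonempty_iff_ne_empty]
    rintro h
    simp [h] at hp1
  obtain ⟨m, -, hm⟩ := exists_max_image univ p hne
  refine ⟨m, ?_⟩
  have hm0 : ∀ x, p x * (1 - p m) ≤ negMulLog (p x) := by
    intro x
    rcases (hp x).eq_or_lt with h | h
    · simp [← h]
    · have h1 := Real.log_le_log h (hm x (mem_univ x))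
      have h2 := Real.log_le_sub_one_of_pos (h.trans_le (hm x (mem_univ x)))
      rw [negMulLog]
      nlinarith
  calc 1 - p m = ∑ x, p x * (1 - p m) := by rw [← sum_mul, hp1, one_mul]
    _ ≤ natEntropy p := sum_le_sum fun x _ => hm0 x

/-- Most of a small entropy comes from the atoms other than the largest one. -/
lemma natEntropy_le_sum_erase [DecidableEq F] {p : F → ℝ} {L : ℝ} (hL : 0 < L)
    (hp : ∀ x, 0 ≤ p x) (hp1 : ∑ x, p x = 1) {m : F} (hm : 1 - p m ≤ exp (-L)) :
    (1 - 2 / L) * natEntropy p ≤ ∑ z ∈ univ.erase m, (negMulLog (p z) - p z) := by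
  have hoff : ∑ z ∈ univ.erase m, p z = 1 - p m := by
    rw [← hp1, ← add_sum_erase univ p (mem_univ m)]; ring
  have hH : natEntropy p = negMulLog (p m) + ∑ z ∈ univ.erase m, negMulLog (p z) :=
    (add_sum_erase univ (fun z => negMulLog (p z)) (mem_univ m)).symm
  have hpm := negMulLog_le_one_sub (hp m)
  have hpm0 := negMulLog_nonneg (hp m) (le_one_of_sum hp hp1 m)
  have hLe : L * (1 - p m) ≤ natEntropy p := by
    rw [hH, ← hoff, mul_sum]
    refine le_trans (sum_le_sum fun z hz => mul_le_negMulLog (hp z) (le_trans ?_ hm)) ?_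
    · rw [← hoff]
      exact single_le_sum (fun i _ => hp i) hz
    · linarith
  have h2 : 1 - p m ≤ natEntropy p / L := by
    rw [le_div_iff₀ hL]; linarith
  rw [sum_sub_distrib, hoff]
  have : (1 - 2 / L) * natEntropy p = natEntropy p - 2 * (natEntropy p / L) := by ring
  linarith

variable [AddCommGroup F]

/-- Mass function of the sum of independent variables with mass functions `p` and `q`. -/
noncomputable def conv (p q : F → ℝ) (z : F) : ℝ := ∑ x, p x * q (z - x)

lemma conv_comm (p q : F → ℝ) : conv p q = conv q p := by
  funext z
  refine Fintype.sum_equiv (Equiv.subLeft z) _ _ fun x => ?_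
  simp [mul_comm]

lemma natEntropy_le_conv {p q : F → ℝ} (hp : ∀ x, 0 ≤ p x) (hp1 : ∑ x, p x = 1)
    (hq : ∀ x, 0 ≤ q x) : natEntropy q ≤ natEntropy (conv p q) := by
  have h1 : ∀ z, ∑ x, p x * negMulLog (q (z - x)) ≤ negMulLog (conv p q z) := fun z => by
    simpa [conv] using concaveOn_negMulLog.le_map_sum (t := univ) (w := p)
      (p := fun x => q (z - x)) (fun x _ => hp x) hp1 (fun x _ => hq _)
  refine le_trans (le_of_eq ?_) (sum_le_sum fun z _ => h1 z)
  rw [sum_comm]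
  have h2 : ∀ x, ∑ z, p x * negMulLog (q (z - x)) = p x * natEntropy q := fun x => by
    rw [← mul_sum, natEntropy]
    congr 1
    exact Fintype.sum_equiv (Equiv.subRight x) _ _ fun z => by simp
  rw [sum_congr rfl fun x _ => h2 x, ← sum_mul, hp1, one_mul]

lemma sum_conv (p q : F → ℝ) : ∑ z, conv p q z = (∑ x, p x) * ∑ y, q y := by
  simp only [conv]
  rw [sum_comm, sum_mul]
  refine sum_congr rfl fun x _ => ?_
  rw [← mul_sum]
  congr 1
  exact Fintype.sum_equiv (Equiv.subRight x) _ _ fun z => by simp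

lemma natEntropy_conv_ge_of_zero {p q : F → ℝ} {L : ℝ} (hL : 2 ≤ L)
    (hp : ∀ x, 0 ≤ p x) (hp1 : ∑ x, p x = 1) (hq : ∀ x, 0 ≤ q x) (hq1 : ∑ x, q x = 1)
    (hp0 : 1 - p 0 ≤ exp (-L)) (hq0 : 1 - q 0 ≤ exp (-L)) :
    (1 - 3 / L) * (natEntropy p + natEntropy q) ≤ natEntropy (conv p q) := by
  classical
  set t := exp (-L) with ht
  have hL0 : 0 < L := by linarith
  have ht0 : 0 < t := exp_pos _
  have htL : t ≤ 1 / L := by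
    rw [ht, exp_neg, ← one_div]
    exact one_div_le_one_div_of_le hL0 (by linarith [add_one_le_exp L])
  have htexp : 2 * t ≤ exp (-1) := by
    have h1 : t ≤ exp (-2) := exp_le_exp.mpr (by linarith)
    have h2 : exp (-1) = exp 1 * exp (-2) := by rw [← exp_add]; norm_num
    have h3 : 2 ≤ exp 1 := by linarith [add_one_le_exp 1]
    rw [h2]
    nlinarith [exp_pos (-2)]
  have ht1 : t ≤ 1 := by
    rw [ht]; exact exp_le_one_iff.mpr (by linarith)
  have hr : ∀ z, 0 ≤ conv p q z := fun z => sum_nonneg fun x _ => mul_nonneg (hp _) (hq _)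
  have hr1 : ∑ z, conv p q z = 1 := by rw [sum_conv, hp1, hq1, one_mul]
  have hr0 : (1 - t) * (1 - t) ≤ conv p q 0 := by
    have : p 0 * q (0 - 0) ≤ conv p q 0 :=
      single_le_sum (f := fun x => p x * q (0 - x)) (fun x _ => mul_nonneg (hp _) (hq _))
        (mem_univ 0)
    rw [sub_zero] at this
    refine le_trans (mul_le_mul ?_ ?_ ?_ (hp 0)) this <;> linarith
  have hoff : ∑ z ∈ univ.erase 0, conv p q z = 1 - conv p q 0 := by
    rw [← hr1, ← add_sum_erase univ (conv p q) (mem_univ 0)]; ring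
  have hstep : ∀ z ∈ univ.erase (0 : F), (1 - t) * ((negMulLog (p z) - p z)
      + (negMulLog (q z) - q z)) ≤ negMulLog (conv p q z) := by
    intro z hz
    have hz0 : z ≠ 0 := ne_of_mem_erase hz
    have hlow : (1 - t) * (p z + q z) ≤ conv p q z := by
      have h : ∑ x ∈ {0, z}, p x * q (z - x) ≤ conv p q z :=
        sum_le_sum_of_subset_of_nonneg (subset_univ _) fun x _ _ => mul_nonneg (hp _) (hq _)
      rw [sum_pair hz0.symm, sub_zero, sub_self] at h
      nlinarith [hp z, hq z]
    have hup : conv p q z ≤ exp (-1) := by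
      have h : conv p q z ≤ 1 - conv p q 0 := by
        rw [← hoff]
        exact single_le_sum (fun i _ => hr i) hz
      nlinarith
    have hpq : 0 ≤ p z + q z := add_nonneg (hp z) (hq z)
    have h1 := negMulLog_mono (mul_nonneg (by linarith) hpq) hlow hup
    rw [negMulLog_mul] at h1
    have h2 : 0 ≤ (p z + q z) * negMulLog (1 - t) :=
      mul_nonneg hpq (negMulLog_nonneg (by linarith) (by linarith))
    have h3 := mul_le_mul_of_nonneg_left (negMulLog_add_ge (hp z) (hq z))
      (by linarith : 0 ≤ 1 - t)
    nlinarith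
  have hsum := sum_le_sum hstep
  rw [← mul_sum, sum_add_distrib] at hsum
  have hH : ∑ z ∈ univ.erase 0, negMulLog (conv p q z) ≤ natEntropy (conv p q) :=
    sum_le_sum_of_subset_of_nonneg (subset_univ _) fun z _ _ =>
      negMulLog_nonneg (hr z) (le_one_of_sum hr hr1 z)
  have h1 := natEntropy_le_sum_erase hL0 hp hp1 hp0
  have h2 := natEntropy_le_sum_erase hL0 hq hq1 hq0
  have hN : 0 ≤ natEntropy p + natEntropy q :=
    add_nonneg (natEntropy_nonneg hp hp1) (natEntropy_nonneg hq hq1)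
  have h3 : (1 - t) * ((1 - 2 / L) * (natEntropy p + natEntropy q)) ≤ natEntropy (conv p q) := by
    refine le_trans (mul_le_mul_of_nonneg_left ?_ (by linarith : 0 ≤ 1 - t)) (hsum.trans hH)
    linarith
  refine le_trans ?_ h3
  rw [← mul_assoc]
  refine mul_le_mul_of_nonneg_right ?_ hN
  have h4 : 3 / L = 2 / L + 1 / L := by ring
  have h5 : 0 < 2 / L := by positivity
  rw [h4]
  nlinarith

/-- For mass functions of small entropy, convolution almost adds the entropies. -/
lemma natEntropy_conv_ge {p q : F → ℝ} {L : ℝ} (hL : 2 ≤ L)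
    (hp : ∀ x, 0 ≤ p x) (hp1 : ∑ x, p x = 1) (hq : ∀ x, 0 ≤ q x) (hq1 : ∑ x, q x = 1)
    (hpL : natEntropy p ≤ exp (-L)) (hqL : natEntropy q ≤ exp (-L)) :
    (1 - 3 / L) * (natEntropy p + natEntropy q) ≤ natEntropy (conv p q) := by
  obtain ⟨a, ha⟩ := exists_one_sub_le_natEntropy hp hp1
  obtain ⟨b, hb⟩ := exists_one_sub_le_natEntropy hq hq1
  have hshift : ∀ (f : F → ℝ) (c : F), ∑ x, f (c + x) = ∑ x, f x := fun f c =>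
    Fintype.sum_equiv (Equiv.addLeft c) _ _ fun x => rfl
  have hnat : ∀ (f : F → ℝ) (c : F), natEntropy (fun x => f (c + x)) = natEntropy f :=
    fun f c => hshift (fun x => negMulLog (f x)) c
  have hconv : conv (fun x => p (a + x)) (fun x => q (b + x))
      = fun z => conv p q (a + b + z) := by
    funext z
    rw [conv, conv, ← hshift (fun x => p x * q (a + b + z - x)) a]
    refine sum_congr rfl fun x _ => ?_
    congr 2
    abel
  have h := natEntropy_conv_ge_of_zero (p := fun x => p (a + x)) (q := fun x => q (b + x)) hL
    (fun x => hp _) (by rw [hshift, hp1]) (fun x => hq _) (by rw [hshift, hq1])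
    (by simpa using ha.trans hpL) (by simpa using hb.trans hqL)
  rwa [hconv, hnat, hnat, hnat] at h

/-- Lower bound for the entropy of a convolution without smallness assumption. -/
lemma natEntropy_conv_ge_mul {p q : F → ℝ} {L : ℝ} (hL : 3 ≤ L)
    (hp : ∀ x, 0 ≤ p x) (hp1 : ∑ x, p x = 1) (hq : ∀ x, 0 ≤ q x) (hq1 : ∑ x, q x = 1) :
    (1 - 3 / L) * ((1 - natEntropy p / exp (-L)) * natEntropy q
      + (1 - natEntropy q / exp (-L)) * natEntropy p) ≤ natEntropy (conv p q) := by
  have hP := natEntropy_nonneg hp hp1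
  have hQ := natEntropy_nonneg hq hq1
  have h1 := natEntropy_le_conv hp hp1 hq
  have h2 := natEntropy_le_conv hq hq1 hp
  rw [conv_comm] at h2
  have ht : 0 < exp (-L) := exp_pos _
  have hP' : 0 ≤ natEntropy p / exp (-L) := by positivity
  have hQ' : 0 ≤ natEntropy q / exp (-L) := by positivity
  have hc : 0 ≤ 1 - 3 / L := by
    rw [sub_nonneg, div_le_one (by linarith)]; exact hL
  have hc1 : 1 - 3 / L ≤ 1 := by
    have : 0 ≤ 3 / L := div_nonneg (by norm_num) (by linarith)
    linarith
  have hsmall : ∀ {h N : ℝ}, 0 ≤ N → 0 ≤ h → (1 - h) * N ≤ N := fun hN hh => by nlinarith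
  have hneg : ∀ {h N : ℝ}, 0 ≤ N → exp (-L) < h → (1 - h / exp (-L)) * N ≤ 0 := by
    intro h N hN hh
    have : 1 < h / exp (-L) := (one_lt_div ht).mpr hh
    nlinarith
  have a1 := hsmall hQ hP'
  have a2 := hsmall hP hQ'
  by_cases hpL : natEntropy p ≤ exp (-L)
  · by_cases hqL : natEntropy q ≤ exp (-L)
    · refine le_trans (mul_le_mul_of_nonneg_left ?_ hc)
        (natEntropy_conv_ge (by linarith) hp hp1 hq hq1 hpL hqL)
      linarith
    · have b := hneg hP (not_le.mp hqL)
      nlinarith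
  · have b := hneg hQ (not_le.mp hpL)
    nlinarith

end Convolution

/-- Averaging a pointwise lower bound over two independent copies of the same weights. -/
lemma avg_ge {T : Type*} [Fintype T] {w h : T → ℝ} {G : T → T → ℝ} {g t : ℝ}
    (hw : ∀ a, 0 ≤ w a) (hw1 : ∑ a, w a = 1) (hh : ∀ a, w a ≠ 0 → 0 ≤ h a)
    (ht : 0 < t) (hg1 : g ≤ 1) (hsm : ∑ a, w a * h a ≤ g * t)
    (hG : ∀ a b, w a ≠ 0 → w b ≠ 0 →
      (1 - g) * ((1 - h a / t) * h b + (1 - h b / t) * h a) ≤ G a b) :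
    (1 - 2 * g) * (2 * ∑ a, w a * h a) ≤ ∑ a, ∑ b, w a * w b * G a b := by
  have hle : ∀ a b, w a * w b * ((1 - g) * ((1 - h a / t) * h b + (1 - h b / t) * h a))
      ≤ w a * w b * G a b := by
    intro a b
    by_cases ha : w a = 0
    · simp [ha]
    by_cases hb : w b = 0
    · simp [hb]
    exact mul_le_mul_of_nonneg_left (hG a b ha hb) (mul_nonneg (hw a) (hw b))
  refine le_trans ?_ (sum_le_sum fun a _ => sum_le_sum fun b _ => hle a b)
  set M := ∑ a, w a * h a with hM
  have hM0 : 0 ≤ M := sum_nonneg fun a _ => by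
    by_cases ha : w a = 0
    · simp [ha]
    · exact mul_nonneg (hw a) (hh a ha)
  have heq : ∑ a, ∑ b, w a * w b * ((1 - g) * ((1 - h a / t) * h b + (1 - h b / t) * h a))
      = (1 - g) * (2 * (M - M * M / t)) := by
    have hpull : ∀ (c : ℝ) (f : T → T → ℝ), ∑ a, ∑ b, c * f a b = c * ∑ a, ∑ b, f a b :=
      fun c f => by simp only [mul_sum]
    have e1 : ∑ a, ∑ b, (w a * (w b * h b)) = M := by
      rw [← sum_mul_sum, hw1, one_mul]
    have e2 : ∑ a, ∑ b, ((w a * h a) * w b) = M := by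
      rw [← sum_mul_sum, hw1, mul_one]
    have e3 : ∑ a, ∑ b, ((w a * h a) * (w b * h b)) = M * M := by
      rw [← sum_mul_sum]
    calc _ = ∑ a, ∑ b, ((1 - g) * (w a * (w b * h b)) + (1 - g) * ((w a * h a) * w b)
          + (1 - g) * (-2 / t) * ((w a * h a) * (w b * h b))) := by
          refine sum_congr rfl fun a _ => sum_congr rfl fun b _ => ?_
          ring
      _ = (1 - g) * M + (1 - g) * M + (1 - g) * (-2 / t) * (M * M) := by
          simp only [sum_add_distrib, hpull, e1, e2, e3]
      _ = _ := by ring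
  rw [heq]
  have hMt : M * M / t ≤ g * M := by
    rw [div_le_iff₀ ht]; nlinarith
  have h1 := mul_le_mul_of_nonneg_left hMt (by linarith : 0 ≤ 1 - g)
  nlinarith [mul_nonneg (sq_nonneg g) hM0]

section Measure

variable {Ω : Type*} [MeasurableSpace Ω] {μ : Measure Ω} {S : Type*} [MeasurableSpace S]
  [MeasurableSingletonClass S]

lemma massOf_nonneg {R : Type*} (X : Ω → R) (x : R) : 0 ≤ massOf μ X x := ENNReal.toReal_nonneg

lemma sum_massOf [Fintype S] [IsProbabilityMeasure μ] {X : Ω → S} (hX : Measurable X) :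
    ∑ x, massOf μ X x = 1 := by
  have h := sum_measureReal_preimage_singleton (μ := μ) univ
    (f := X) fun y _ => hX (measurableSet_singleton y)
  simpa [massOf, Measure.real] using h

lemma massOf_cond {R : Type*} {B : Set Ω} (hB : MeasurableSet B) (X : Ω → R) (x : R) :
    massOf (μ[|B]) X x = (μ B).toReal⁻¹ * (μ (B ∩ X ⁻¹' {x})).toReal := by
  rw [massOf, cond_apply hB, ENNReal.toReal_mul, ENNReal.toReal_inv]

variable {T₁ T₂ : Type*} [MeasurableSpace T₁] [MeasurableSpace T₂]
  [MeasurableSingletonClass T₁] [MeasurableSingletonClass T₂]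

lemma massOf_prodMk {A₁ : Ω → T₁} {A₂ : Ω → T₂} (h : IndepFun A₁ A₂ μ) (a : T₁) (b : T₂) :
    massOf μ (fun ω => (A₁ ω, A₂ ω)) (a, b) = massOf μ A₁ a * massOf μ A₂ b := by
  have h1 := h.measure_inter_preimage_eq_mul {a} {b} (measurableSet_singleton a)
    (measurableSet_singleton b)
  have h2 : (fun ω => (A₁ ω, A₂ ω)) ⁻¹' {(a, b)} = A₁ ⁻¹' {a} ∩ A₂ ⁻¹' {b} := by
    ext ω; simp
  rw [massOf, massOf, massOf, h2, h1, ENNReal.toReal_mul]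

/-- Conditionally on `A₁ = a` and `A₂ = b`, the sum `X₁ + X₂` is distributed as the
convolution of the conditional laws. -/
lemma massOf_cond_add {F : Type*} [Fintype F] [AddCommGroup F] [MeasurableSpace F]
    [MeasurableSingletonClass F] [IsProbabilityMeasure μ]
    {X₁ X₂ : Ω → F} {A₁ : Ω → T₁} {A₂ : Ω → T₂}
    (hX₁ : Measurable X₁) (hA₁ : Measurable A₁) (hA₂ : Measurable A₂)
    (hind : IndepFun (fun ω => (X₁ ω, A₁ ω)) (fun ω => (X₂ ω, A₂ ω)) μ) (a : T₁) (b : T₂) :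
    massOf (μ[|(fun ω => (A₁ ω, A₂ ω)) ⁻¹' {(a, b)}]) (fun ω => X₁ ω + X₂ ω)
      = conv (massOf (μ[|A₁ ⁻¹' {a}]) X₁) (massOf (μ[|A₂ ⁻¹' {b}]) X₂) := by
  funext z
  have hA : IndepFun A₁ A₂ μ := hind.comp measurable_snd measurable_snd
  have hB₁ : MeasurableSet (A₁ ⁻¹' {a}) := hA₁ (measurableSet_singleton a)
  have hB₂ : MeasurableSet (A₂ ⁻¹' {b}) := hA₂ (measurableSet_singleton b)
  have hB : MeasurableSet ((fun ω => (A₁ ω, A₂ ω)) ⁻¹' {(a, b)}) :=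
    (hA₁.prodMk hA₂) (measurableSet_singleton _)
  have hmass := massOf_prodMk hA a b
  simp only [massOf] at hmass
  rw [massOf_cond hB, hmass, conv]
  simp only [massOf_cond hB₁, massOf_cond hB₂]
  have hset : ∀ x, (A₁ ⁻¹' {a} ∩ X₁ ⁻¹' {x}) ∩ (A₂ ⁻¹' {b} ∩ X₂ ⁻¹' {z - x})
      = ((fun ω => (A₁ ω, A₂ ω)) ⁻¹' {(a, b)} ∩ (fun ω => X₁ ω + X₂ ω) ⁻¹' {z})
        ∩ X₁ ⁻¹' {x} := by
    intro x
    ext ω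
    simp only [Set.mem_inter_iff, Set.mem_preimage, Set.mem_singleton_iff, Prod.mk.injEq]
    constructor
    · rintro ⟨⟨h1, h2⟩, h3, h4⟩
      exact ⟨⟨⟨h1, h3⟩, by rw [h2, h4]; abel⟩, h2⟩
    · rintro ⟨⟨⟨h1, h3⟩, h4⟩, h2⟩
      exact ⟨⟨h1, h2⟩, h3, by rw [← h4, h2]; abel⟩
  have hmul : ∀ x, (μ (A₁ ⁻¹' {a} ∩ X₁ ⁻¹' {x})).toReal
      * (μ (A₂ ⁻¹' {b} ∩ X₂ ⁻¹' {z - x})).toReal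
      = (μ (((fun ω => (A₁ ω, A₂ ω)) ⁻¹' {(a, b)} ∩ (fun ω => X₁ ω + X₂ ω) ⁻¹' {z})
        ∩ X₁ ⁻¹' {x})).toReal := by
    intro x
    have h1 := hind.measure_inter_preimage_eq_mul {(x, a)} {(z - x, b)}
      (measurableSet_singleton _) (measurableSet_singleton _)
    have e1 : (fun ω => (X₁ ω, A₁ ω)) ⁻¹' {(x, a)} = A₁ ⁻¹' {a} ∩ X₁ ⁻¹' {x} := by
      ext ω; simp [and_comm]
    have e2 : (fun ω => (X₂ ω, A₂ ω)) ⁻¹' {(z - x, b)} = A₂ ⁻¹' {b} ∩ X₂ ⁻¹' {z - x} := by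
      ext ω; simp [and_comm]
    rw [e1, e2] at h1
    rw [← hset, h1, ENNReal.toReal_mul]
  have htotal : (μ ((fun ω => (A₁ ω, A₂ ω)) ⁻¹' {(a, b)}
      ∩ (fun ω => X₁ ω + X₂ ω) ⁻¹' {z})).toReal
      = ∑ x, (μ (((fun ω => (A₁ ω, A₂ ω)) ⁻¹' {(a, b)} ∩ (fun ω => X₁ ω + X₂ ω) ⁻¹' {z})
        ∩ X₁ ⁻¹' {x})).toReal := by
    set E := (fun ω => (A₁ ω, A₂ ω)) ⁻¹' {(a, b)} ∩ (fun ω => X₁ ω + X₂ ω) ⁻¹' {z}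
    have h := sum_measureReal_preimage_singleton (μ := μ.restrict E) univ
      (f := X₁) fun y _ => hX₁ (measurableSet_singleton y)
    simp only [Measure.real, coe_univ, Set.preimage_univ, Measure.restrict_apply_univ] at h
    rw [← h]
    refine sum_congr rfl fun x _ => ?_
    rw [Measure.restrict_apply (hX₁ (measurableSet_singleton x)), Set.inter_comm]
  rw [htotal, mul_sum]
  refine sum_congr rfl fun x _ => ?_
  rw [← hmul]
  ring

end Measure

lemma nEntropy_eq {Ω : Type*} [MeasurableSpace Ω] (μ : Measure Ω) {S : Type*} [Fintype S]
    (X : Ω → S) : nEntropy μ X =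
      natEntropy (massOf μ X) / (Real.log 2 * Real.logb 2 (Fintype.card S)) := by
  rw [nEntropy, entropy, natEntropy, div_div]

lemma nCondEntropy_eq {Ω : Type*} [MeasurableSpace Ω] (μ : Measure Ω) {S T : Type*}
    [Fintype S] [Fintype T] (X : Ω → S) (Y : Ω → T) : nCondEntropy μ X Y =
      (∑ b, massOf μ Y b * natEntropy (massOf (μ[|Y ⁻¹' {b}]) X))
        / (Real.log 2 * Real.logb 2 (Fintype.card S)) := by
  simp only [nCondEntropy, condEntropy, entropy, natEntropy, mul_div_assoc']
  rw [← sum_div, div_div]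

end SuctionLowerEnd

open SuctionLowerEnd in
/-- **Lemma (suction at the lower end, conditional sum version).** For every finite field
`F_q` and `γ > 0` there is `τ > 0` such that: if `(X₁, A₁)` and `(X₂, A₂)` are independent
pairs with `X₁, X₂ ∈ F_q`, `A₁` and `A₂` identically distributed, and
`H̄(X₁ | A₁ = a) = H̄(X₂ | A₂ = a)` for every value `a`, then `H̄(X₁|A₁) ≤ τ` implies
`H̄(X₁+X₂ | A₁, A₂) ≥ (1 − γ)(H̄(X₁|A₁) + H̄(X₂|A₂))`. -/
theorem suction_at_lower_end_sum
    (F : Type*) [Field F] [Fintype F] [MeasurableSpace F] [MeasurableSingletonClass F]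
    (γ : ℝ) (hγ : 0 < γ) :
    ∃ τ : ℝ, 0 < τ ∧
      ∀ (Ω : Type) [MeasurableSpace Ω] (μ : Measure Ω) [IsProbabilityMeasure μ]
        (T : Type) [Fintype T] [MeasurableSpace T] [MeasurableSingletonClass T]
        (X₁ X₂ : Ω → F) (A₁ A₂ : Ω → T),
        Measurable X₁ → Measurable X₂ → Measurable A₁ → Measurable A₂ →
        IndepFun (fun ω => (X₁ ω, A₁ ω)) (fun ω => (X₂ ω, A₂ ω)) μ →
        IdentDistrib A₁ A₂ μ μ →
        (∀ a : T, nEntropy (μ[|A₁ ⁻¹' {a}]) X₁ = nEntropy (μ[|A₂ ⁻¹' {a}]) X₂) →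
        nCondEntropy μ X₁ A₁ ≤ τ →
        (1 - γ) * (nCondEntropy μ X₁ A₁ + nCondEntropy μ X₂ A₂) ≤
          nCondEntropy μ (fun ω => X₁ ω + X₂ ω) (fun ω => (A₁ ω, A₂ ω)) := by
  set K : ℝ := Real.log 2 * Real.logb 2 (Fintype.card F) with hK
  have hK0 : 0 < K := mul_pos (Real.log_pos one_lt_two)
    (Real.logb_pos one_lt_two (by exact_mod_cast Fintype.one_lt_card))
  set g : ℝ := min (γ / 2) 1 with hg
  have hg0 : 0 < g := lt_min (by linarith) one_pos
  have hg1 : g ≤ 1 := min_le_right _ _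
  have hgγ : 2 * g ≤ γ := by linarith [min_le_left (γ / 2) 1]
  set L : ℝ := 3 / g with hLdef
  have hL : 3 ≤ L := by rw [hLdef, le_div_iff₀ hg0]; linarith
  have hgL : 3 / L = g := by rw [hLdef]; field_simp
  refine ⟨g * exp (-L) / K, by positivity, ?_⟩
  intro Ω _ μ _ T _ _ _ X₁ X₂ A₁ A₂ hX₁ hX₂ hA₁ hA₂ hind hid hent hsmall
  have hw : ∀ a, massOf μ A₂ a = massOf μ A₁ a := fun a => by
    rw [massOf, massOf, hid.measure_preimage_eq (measurableSet_singleton a)]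
  have hh : ∀ a, natEntropy (massOf (μ[|A₂ ⁻¹' {a}]) X₂)
      = natEntropy (massOf (μ[|A₁ ⁻¹' {a}]) X₁) := fun a => by
    have h := hent a
    rw [nEntropy_eq, nEntropy_eq, div_left_inj' hK0.ne'] at h
    exact h.symm
  have hprob : ∀ (A : Ω → T) (a : T), massOf μ A a ≠ 0 →
      IsProbabilityMeasure (μ[|A ⁻¹' {a}]) := fun A a ha =>
    cond_isProbabilityMeasure fun h => ha (by simp [massOf, h])
  have hA : IndepFun A₁ A₂ μ := hind.comp measurable_snd measurable_snd
  rw [nCondEntropy_eq, div_le_div_iff_of_pos_right hK0] at hsmall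
  rw [nCondEntropy_eq, nCondEntropy_eq, nCondEntropy_eq, ← add_div, mul_div_assoc',
    div_le_div_iff_of_pos_right hK0, Fintype.sum_prod_type]
  simp only [massOf_prodMk hA, massOf_cond_add hX₁ hA₁ hA₂ hind, hw, hh]
  have hnn : ∀ a, massOf μ A₁ a ≠ 0 → 0 ≤ natEntropy (massOf (μ[|A₁ ⁻¹' {a}]) X₁) :=
    fun a ha => by
      have := hprob A₁ a ha
      exact natEntropy_nonneg (massOf_nonneg X₁) (sum_massOf hX₁)
  have hmain := avg_ge (w := massOf μ A₁)
    (h := fun a => natEntropy (massOf (μ[|A₁ ⁻¹' {a}]) X₁))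
    (G := fun a b => natEntropy (conv (massOf (μ[|A₁ ⁻¹' {a}]) X₁)
      (massOf (μ[|A₂ ⁻¹' {b}]) X₂))) (massOf_nonneg A₁) (sum_massOf hA₁) hnn
    (exp_pos (-L)) hg1 hsmall (by
      intro a b ha hb
      have := hprob A₁ a ha
      have := hprob A₂ b (by rwa [hw])
      have h := natEntropy_conv_ge_mul hL (massOf_nonneg X₁)
        (sum_massOf (μ := μ[|A₁ ⁻¹' {a}]) hX₁) (massOf_nonneg X₂)
        (sum_massOf (μ := μ[|A₂ ⁻¹' {b}]) hX₂)
      rwa [hgL, hh] at h)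
  refine le_trans ?_ hmain
  rw [← two_mul]
  refine mul_le_mul_of_nonneg_right (by linarith) (mul_nonneg zero_le_two ?_)
  refine sum_nonneg fun a _ => ?_
  by_cases ha : massOf μ A₁ a = 0
  · simp [ha]
  · exact mul_nonneg (massOf_nonneg A₁ a) (hnn a ha)
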